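/- arXiv:1310.2930 — 2 statements merged into one kernel-verified Lean document; each statement's English description precedes it below -/
import Mathlib

section
/- Let ν ⊆ μ be partitions with |μ| = |ν| + 1. If μ covers ν, then μ' covers ν'. -/
/-- A partition, 0-indexed: `f i` is the `(i+1)`-st part. A partition is a weakly
decreasing, eventually zero function `ℕ → ℕ`. -/
def IsPartition (f : ℕ → ℕ) : Prop := Antitone f ∧ ∃ N, f N = 0

/-- The number of (nonzero) parts of a partition. -/
noncomputable def plen (f : ℕ → ℕ) : ℕ := sInf {n | f n = 0}

/-- The size (weight) of a partition: the sum of its parts. -/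
noncomputable def psize (f : ℕ → ℕ) : ℕ := ∑ i ∈ Finset.range (plen f), f i

/-- Containment of partitions: `subP f g` means `f ⊆ g`, i.e. `f i ≤ g i` for all `i`. -/
def subP (f g : ℕ → ℕ) : Prop := ∀ i, f i ≤ g i

/-- The conjugate partition: `conjP f j = #{i : f i > j}` (0-indexed). -/
noncomputable def conjP (f : ℕ → ℕ) : ℕ → ℕ := fun j => Nat.card {i : ℕ // j < f i}

/-- The square partition `(s^s)`. -/
def squareP (s : ℕ) : ℕ → ℕ := fun j => if j < s then s else 0

/-- The partition `(s^s, 1)`: `s` parts equal to `s` followed by a part equal to `1`. -/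
def squareP1 (s : ℕ) : ℕ → ℕ := fun j => if j < s then s else if j = s then 1 else 0

/-- The complement of `f` in the square `(m^m)`: the `(i+1)`-st part (0-indexed `i < m`)
is `m - f (m - 1 - i)`. -/
def complP (m : ℕ) (f : ℕ → ℕ) : ℕ → ℕ := fun i => if i < m then m - f (m - 1 - i) else 0

/-- `ν + (1)`: add one box at the end of the first row. -/
def addRow1 (f : ℕ → ℕ) : ℕ → ℕ := fun j => if j = 0 then f 0 + 1 else f j

/-- `(ν, 1)`: append a part equal to `1` after the last nonzero part. -/
noncomputable def addPart1 (f : ℕ → ℕ) : ℕ → ℕ :=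
  fun j => if j < plen f then f j else if j = plen f then 1 else 0

/-- Delete the first `k` columns of a partition. -/
def colDel (k : ℕ) (f : ℕ → ℕ) : ℕ → ℕ := fun j => f j - k

/-- Delete the first `s` rows of a partition. -/
def rowDel (s : ℕ) (f : ℕ → ℕ) : ℕ → ℕ := fun j => f (j + s)

/-- The sequence whose first `m` entries are given by `f` and whose subsequent entries
are given by `g`; used to form `(η^{c,m} + γ, σ)`. -/
def appendAfter (m : ℕ) (f g : ℕ → ℕ) : ℕ → ℕ := fun i => if i < m then f i else g (i - m)

/-- The cell in row `r`, column `c` (both 0-indexed) belongs to the skew diagram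
`lam/alpha`. -/
def inShape (lam alpha : ℕ → ℕ) (r c : ℕ) : Prop := alpha r ≤ c ∧ c < lam r

/-- A Littlewood–Richardson tableau of shape `lam/alpha` and content `beta`
(for each `k`, there are `beta k` entries equal to `k + 1`): a semistandard filling of
the skew diagram whose reverse reading word is a lattice permutation.  The lattice
condition is expressed by comparing, in every prefix of the reverse reading word ending
at a cell `(r, c)` (all cells in rows above `r`, together with the cells in row `r`
weakly to the right of column `c`), the number of entries `k + 2` with the number of
entries `k + 1`. -/
structure LRTableau (lam alpha beta : ℕ → ℕ) where
  entry : ℕ → ℕ → ℕ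
  zero_outside : ∀ r c, ¬ inShape lam alpha r c → entry r c = 0
  one_le : ∀ r c, inShape lam alpha r c → 1 ≤ entry r c
  row_weak : ∀ r c₁ c₂, c₁ ≤ c₂ → inShape lam alpha r c₁ → inShape lam alpha r c₂ →
    entry r c₁ ≤ entry r c₂
  col_strict : ∀ r₁ r₂ c, r₁ < r₂ → inShape lam alpha r₁ c → inShape lam alpha r₂ c →
    entry r₁ c < entry r₂ c
  content : ∀ k : ℕ,
    Nat.card {p : ℕ × ℕ // inShape lam alpha p.1 p.2 ∧ entry p.1 p.2 = k + 1} = beta k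
  lattice : ∀ r c k : ℕ, inShape lam alpha r c →
    Nat.card {p : ℕ × ℕ // inShape lam alpha p.1 p.2 ∧
        (p.1 < r ∨ (p.1 = r ∧ c ≤ p.2)) ∧ entry p.1 p.2 = k + 2} ≤
    Nat.card {p : ℕ × ℕ // inShape lam alpha p.1 p.2 ∧
        (p.1 < r ∨ (p.1 = r ∧ c ≤ p.2)) ∧ entry p.1 p.2 = k + 1}

open Classical in
/-- The Littlewood–Richardson coefficient `c^lam_{alpha, beta}`: the number of LR
tableaux of shape `lam/alpha` and content `beta`, or `0` if `alpha ⊄ lam`. -/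
noncomputable def LRcoeff (lam alpha beta : ℕ → ℕ) : ℕ :=
  if subP alpha lam then Nat.card (LRTableau lam alpha beta) else 0

/-- `mu` covers `nu`: for every integer `m ≥ μ₁ + ℓ(μ)` and every partition `lam`,
`c^lam_{ν^{c,m}, ν'} ≤ c^lam_{μ^{c,m}, μ'}`, i.e. `s_{μ'} s_{μ^c} - s_{ν'} s_{ν^c}`
is Schur-positive (complements taken in `(m^m)`). -/
def Covers (mu nu : ℕ → ℕ) : Prop :=
  ∀ m : ℕ, mu 0 + plen mu ≤ m → ∀ lam : ℕ → ℕ, IsPartition lam →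
    LRcoeff lam (complP m nu) (conjP nu) ≤ LRcoeff lam (complP m mu) (conjP mu)

/-- The partition `(i^{s+1}, i, i-1, ..., 2, 1)` (as a 0-indexed function). -/
def betaShape (i s : ℕ) : ℕ → ℕ := fun j => if j ≤ s + 1 then i else i + s + 1 - j

/-- A partition is of type 1 if it contains `(i, i, i-1, ..., 2, 1)` where `i` is its
first part. -/
def Type1 (nu : ℕ → ℕ) : Prop := IsPartition nu ∧ subP (betaShape (nu 0) 0) nu

/-- `nu = beta + (s^s) + alpha` (componentwise) is a type-2 decomposition: `s ≥ 1`,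
`alpha` is a nonempty partition with at most `s` parts, and `beta` is a (possibly empty)
partition containing `(i^{s+1}, i, i-1, ..., 2, 1)` where `i = beta 0`. -/
def IsType2Decomp (nu beta : ℕ → ℕ) (s : ℕ) (alpha : ℕ → ℕ) : Prop :=
  IsPartition beta ∧ IsPartition alpha ∧ 1 ≤ s ∧ alpha 0 ≠ 0 ∧ plen alpha ≤ s ∧
    subP (betaShape (beta 0) s) beta ∧ ∀ j, nu j = beta j + squareP s j + alpha j

/-- A partition is of type 2 if it admits a type-2 decomposition. -/
def Type2 (nu : ℕ → ℕ) : Prop := ∃ beta s alpha, IsType2Decomp nu beta s alpha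

/-- A self-conjugate partition. -/
def SelfConjugate (t : ℕ → ℕ) : Prop := ∀ j, conjP t j = t j

/-- A partition `nu` is corner-symmetric if for every outer corner of `nu` in row
`r + 1 ≥ 2` (1-indexed), i.e. every 0-indexed row `r ≥ 1` with `nu r < nu (r-1)`
(the corner cell lying in 0-indexed column `nu r`), there is a nonempty partition
`η ⊆ nu` such that the skew diagram `nu/η` is, up to translation, the Young diagram of
a self-conjugate partition, contains the cell `(r-1, nu r)` (0-indexed), and contains
no cell in any column of 0-indexed column index `< nu r`. -/
def CornerSymmetric (nu : ℕ → ℕ) : Prop :=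
  ∀ r : ℕ, 1 ≤ r → nu r < nu (r - 1) →
    ∃ η : ℕ → ℕ, IsPartition η ∧ subP η nu ∧ η 0 ≠ 0 ∧
      ∃ t : ℕ → ℕ, ∃ r0 c0 : ℕ, IsPartition t ∧ SelfConjugate t ∧
        (∀ a b : ℕ, (η a ≤ b ∧ b < nu a) ↔ (r0 ≤ a ∧ c0 ≤ b ∧ b - c0 < t (a - r0))) ∧
        η (r - 1) ≤ nu r ∧
        (∀ a b : ℕ, η a ≤ b → b < nu a → nu r ≤ b)

/-- The cells `X` of a skew diagram, placed in the plane by `row` and `col`. -/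
structure IsSkew {X : Type*} (row col : X → ℤ) : Prop where
  inj : ∀ x y, row x = row y → col x = col y → x = y
  convex : ∀ x y r c, row x ≤ r → r ≤ row y → col x ≤ c → c ≤ col y →
    ∃ z, row z = r ∧ col z = c

/-- Semistandard fillings of a diagram with entries in `Fin n`. -/
structure IsSemistd {X : Type*} {n : ℕ} (row col : X → ℤ) (T : X → Fin n) : Prop where
  row_weak : ∀ x y, row x = row y → col x ≤ col y → T x ≤ T y
  col_strict : ∀ x y, col x = col y → row x < row y → T x < T y

/-- The number of entries `i` in the columns with index at least `j`. -/
def colWt {X : Type*} [Fintype X] {n : ℕ} (col : X → ℤ) (T : X → Fin n) (j : ℤ) (i : Fin n) : ℕ :=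
  (Finset.univ.filter fun x => j ≤ col x ∧ T x = i).card

/-- The content of a filling. -/
def wt {X : Type*} [Fintype X] {n : ℕ} (T : X → Fin n) (i : Fin n) : ℕ :=
  (Finset.univ.filter fun x => T x = i).card

/-- The lattice condition, read along columns from right to left. -/
def IsLattice {X : Type*} [Fintype X] {n : ℕ} (col : X → ℤ) (T : X → Fin n) : Prop :=
  ∀ (j : ℤ) (a b : Fin n), (a : ℕ) + 1 = b → colWt col T j b ≤ colWt col T j a

theorem IsSkew.neg {X : Type*} {row col : X → ℤ} (h : IsSkew row col) :
    IsSkew (-row) (-col) where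
  inj x y h1 h2 := h.inj x y (by simpa using h1) (by simpa using h2)
  convex x y r c h1 h2 h3 h4 := by
    simp only [Pi.neg_apply] at *
    obtain ⟨z, hz1, hz2⟩ := h.convex y x (-r) (-c) (by omega) (by omega) (by omega) (by omega)
    exact ⟨z, by omega, by omega⟩

theorem IsSkew.transpose {X : Type*} {row col : X → ℤ} (h : IsSkew row col) :
    IsSkew col row where
  inj x y h1 h2 := h.inj x y h2 h1
  convex x y r c h1 h2 h3 h4 := by
    obtain ⟨z, hz1, hz2⟩ := h.convex x y c r h3 h4 h1 h2
    exact ⟨z, hz2, hz1⟩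

/-- Every finite set of integers has an order-reversing involution. -/
theorem exists_antitone_involution (G : Finset ℤ) :
    ∃ ρ : ℤ → ℤ, (∀ c ∈ G, ρ c ∈ G) ∧ (∀ c ∈ G, ρ (ρ c) = c) ∧
      ∀ c ∈ G, ∀ d ∈ G, c ≤ d → ρ d ≤ ρ c := by
  let e := G.orderIsoOfFin rfl
  refine ⟨fun c => if h : c ∈ G then e (Fin.rev (e.symm ⟨c, h⟩)) else c, ?_, ?_, ?_⟩
  · intro c hc
    simp [hc]
  · intro c hc
    simp [hc]
  · intro c hc d hd hcd
    simpa [hc, hd] using hcd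

/-- `x` is the only cell of `D` in its column. -/
def AloneInCol {X : Type*} (col : X → ℤ) (D : Finset X) (x : X) : Prop :=
  ∀ y ∈ D, col y = col x → y = x

/-- The involution of the cells of a two-letter band underlying the Bender–Knuth involution:
it exchanges the two cells of each two-cell column, and reverses the remaining cells
of each row. -/
structure IsBandInvolution {X : Type*} (row col : X → ℤ) (D : Finset X) (τ : X → X) : Prop where
  mem : ∀ x ∈ D, τ x ∈ D
  invol : ∀ x ∈ D, τ (τ x) = x
  pair_col : ∀ x ∈ D, ¬ AloneInCol col D x → col (τ x) = col x
  pair_ne : ∀ x ∈ D, ¬ AloneInCol col D x → τ x ≠ x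
  alone_row : ∀ x ∈ D, AloneInCol col D x → row (τ x) = row x
  alone_anti : ∀ x ∈ D, ∀ y ∈ D, AloneInCol col D x → AloneInCol col D y → row x = row y →
    col x ≤ col y → col (τ y) ≤ col (τ x)

theorem exists_bandInvolution {X : Type*} {row col : X → ℤ}
    (h : IsSkew row col) (D : Finset X)
    (hD : ∀ x ∈ D, ∀ y ∈ D, ∀ z ∈ D, col x = col y → col x = col z → x ≠ y → x ≠ z → y = z) :
    ∃ τ : X → X, IsBandInvolution row col D τ := by
  classical
  choose ρ hρ1 hρ2 hρ3 using fun r : ℤ => exists_antitone_involution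
    ((D.filter fun x => AloneInCol col D x ∧ row x = r).image col)
  have mem_im : ∀ x ∈ D, AloneInCol col D x →
      col x ∈ (D.filter fun y => AloneInCol col D y ∧ row y = row x).image col := fun x hx ha =>
    Finset.mem_image_of_mem _ (by simp [hx, ha])
  have hrow : ∀ x, ∃ z, x ∈ D → AloneInCol col D x →
      z ∈ D ∧ AloneInCol col D z ∧ row z = row x ∧ col z = ρ (row x) (col x) := by
    intro x
    by_cases hx : x ∈ D ∧ AloneInCol col D x
    · have := hρ1 (row x) (col x) (mem_im x hx.1 hx.2)
      simp only [Finset.mem_image, Finset.mem_filter] at this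
      obtain ⟨z, ⟨hz1, hz2, hz3⟩, hz4⟩ := this
      exact ⟨z, fun _ _ => ⟨hz1, hz2, hz3, hz4⟩⟩
    · exact ⟨x, fun h1 h2 => absurd ⟨h1, h2⟩ hx⟩
  have hcol : ∀ x, ∃ z, x ∈ D → ¬ AloneInCol col D x → z ∈ D ∧ col z = col x ∧ z ≠ x := by
    intro x
    by_cases hx : AloneInCol col D x
    · exact ⟨x, fun _ h2 => absurd hx h2⟩
    · have hx' := hx
      simp only [AloneInCol, not_forall] at hx'
      obtain ⟨z, hz1, hz2, hz3⟩ := hx'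
      exact ⟨z, fun _ _ => ⟨hz1, hz2, hz3⟩⟩
  choose f hf using hrow
  choose g hg using hcol
  refine ⟨fun x => if AloneInCol col D x then f x else g x, ?_, ?_, ?_, ?_, ?_, ?_⟩
  · intro x hx
    by_cases ha : AloneInCol col D x
    · simpa [ha] using (hf x hx ha).1
    · simpa [ha] using (hg x hx ha).1
  · intro x hx
    by_cases ha : AloneInCol col D x
    · obtain ⟨h1, h2, h3, h4⟩ := hf x hx ha
      obtain ⟨-, -, h3', h4'⟩ := hf _ h1 h2
      simp only [ha, h2, if_true]
      refine h.inj _ _ (h3'.trans h3) ?_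
      rw [h4', h3, h4, hρ2 _ _ (mem_im x hx ha)]
    · obtain ⟨h1, h2, h3⟩ := hg x hx ha
      have hb : ¬ AloneInCol col D (g x) := fun hb => h3 (hb x hx h2.symm).symm
      obtain ⟨h1', h2', h3'⟩ := hg _ h1 hb
      simp only [ha, hb, if_false]
      exact hD (g x) h1 _ h1' x hx h2'.symm h2 (Ne.symm h3') h3
  · intro x hx ha
    simpa [ha] using (hg x hx ha).2.1
  · intro x hx ha
    simpa [ha] using (hg x hx ha).2.2
  · intro x hx ha
    simpa [ha] using (hf x hx ha).2.2.1
  · intro x hx y hy ha hb hr hc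
    simp only [ha, hb, if_true]
    rw [(hf x hx ha).2.2.2, (hf y hy hb).2.2.2, ← hr]
    exact hρ3 _ _ (mem_im x hx ha) _ (hr ▸ mem_im y hy hb) hc

open Classical in
/-- A chosen band involution, depending only on the band. -/
noncomputable def bandInvolution {X : Type*} (row col : X → ℤ) (D : Finset X) : X → X :=
  if h : ∃ τ, IsBandInvolution row col D τ then h.choose else id

theorem bandInvolution_spec {X : Type*} {row col : X → ℤ}
    (h : IsSkew row col) (D : Finset X)
    (hD : ∀ x ∈ D, ∀ y ∈ D, ∀ z ∈ D, col x = col y → col x = col z → x ≠ y → x ≠ z → y = z) :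
    IsBandInvolution row col D (bandInvolution row col D) := by
  have h' := exists_bandInvolution h D hD
  rw [bandInvolution, dif_pos h']
  exact h'.choose_spec

/-- The cells to the left of column `j` with entry `a` or `b`. -/
def band {X : Type*} [Fintype X] {n : ℕ} (col : X → ℤ) (j : ℤ) (a b : Fin n) (T : X → Fin n) :
    Finset X :=
  Finset.univ.filter fun x => col x < j ∧ (T x = a ∨ T x = b)

open Classical in
/-- The Bender–Knuth involution exchanging the letters `a` and `b` to the left of column `j`. -/
noncomputable def benderKnuth {X : Type*} [Fintype X] {n : ℕ} (row col : X → ℤ) (j : ℤ)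
    (a b : Fin n) (T : X → Fin n) : X → Fin n := fun x =>
  if x ∈ band col j a b T then
    Equiv.swap a b (T (bandInvolution row col (band col j a b T) x))
  else T x

section BenderKnuth

variable {X : Type*} [Fintype X] {n : ℕ} {row col : X → ℤ} {j : ℤ} {a b : Fin n} {T : X → Fin n}

theorem mem_band {x : X} : x ∈ band col j a b T ↔ col x < j ∧ (T x = a ∨ T x = b) := by
  simp [band]

theorem bandInvolution_band (h : IsSkew row col) (hT : IsSemistd row col T) :
    IsBandInvolution row col (band col j a b T)
      (bandInvolution row col (band col j a b T)) := by
  refine bandInvolution_spec h _ ?_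
  intro x hx y hy z hz hxy hxz hne hne'
  have key : ∀ u v, col u = col v → u ≠ v → T u ≠ T v := by
    intro u v huv hne
    rcases lt_trichotomy (row u) (row v) with h1 | h1 | h1
    · exact (hT.col_strict _ _ huv h1).ne
    · exact absurd (h.inj _ _ h1 huv) hne
    · exact (hT.col_strict _ _ huv.symm h1).ne'
  by_contra hyz
  have h1 := key _ _ hxy hne
  have h2 := key _ _ hxz hne'
  have h3 := key _ _ (hxy.symm.trans hxz) hyz
  rw [mem_band] at hx hy hz
  grind

theorem benderKnuth_of_mem {x : X} (hx : x ∈ band col j a b T) :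
    benderKnuth row col j a b T x =
      Equiv.swap a b (T (bandInvolution row col (band col j a b T) x)) := by
  simp [benderKnuth, hx]

theorem benderKnuth_of_notMem {x : X} (hx : x ∉ band col j a b T) :
    benderKnuth row col j a b T x = T x := by
  simp [benderKnuth, hx]

theorem benderKnuth_of_le {x : X} (hx : j ≤ col x) :
    benderKnuth row col j a b T x = T x :=
  benderKnuth_of_notMem (by rw [mem_band]; omega)

theorem benderKnuth_mem_pair (h : IsSkew row col) (hT : IsSemistd row col T) {x : X}
    (hx : x ∈ band col j a b T) :
    benderKnuth row col j a b T x = a ∨ benderKnuth row col j a b T x = b := by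
  rw [benderKnuth_of_mem hx]
  have := (mem_band.1 ((bandInvolution_band h hT).mem x hx)).2
  rcases this with h | h <;> simp [h]

theorem band_benderKnuth (h : IsSkew row col) (hT : IsSemistd row col T) :
    band col j a b (benderKnuth row col j a b T) = band col j a b T := by
  ext x
  by_cases hx : x ∈ band col j a b T
  · simp only [hx, iff_true]
    exact mem_band.2 ⟨(mem_band.1 hx).1, benderKnuth_mem_pair h hT hx⟩
  · rw [mem_band, benderKnuth_of_notMem hx, ← mem_band]

theorem benderKnuth_benderKnuth (h : IsSkew row col) (hT : IsSemistd row col T) :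
    benderKnuth row col j a b (benderKnuth row col j a b T) = T := by
  ext x
  congr 1
  by_cases hx : x ∈ band col j a b T
  · have hB := bandInvolution_band (j := j) (a := a) (b := b) h hT
    rw [benderKnuth_of_mem (by rwa [band_benderKnuth h hT]), band_benderKnuth h hT,
      benderKnuth_of_mem (hB.mem x hx), hB.invol x hx, Equiv.swap_apply_self]
  · rw [benderKnuth_of_notMem (by rwa [band_benderKnuth h hT]), benderKnuth_of_notMem hx]

theorem benderKnuth_of_not_alone (h : IsSkew row col) (hT : IsSemistd row col T)
    {x : X} (hx : x ∈ band col j a b T) (ha : ¬ AloneInCol col (band col j a b T) x) :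
    benderKnuth row col j a b T x = T x := by
  have hB := bandInvolution_band (j := j) (a := a) (b := b) h hT
  rw [benderKnuth_of_mem hx]
  set y := bandInvolution row col (band col j a b T) x with hy
  have hc : col y = col x := hB.pair_col x hx ha
  have hne : y ≠ x := hB.pair_ne x hx ha
  have h1 := (mem_band.1 hx).2
  have h2 := (mem_band.1 (hB.mem x hx)).2
  have h3 : T y ≠ T x := by
    rcases lt_trichotomy (row y) (row x) with h1 | h1 | h1
    · exact (hT.col_strict _ _ hc h1).ne
    · exact absurd (h.inj _ _ h1 hc) hne
    · exact (hT.col_strict _ _ hc.symm h1).ne'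
  rw [← hy] at h2
  rcases h1 with h1 | h1 <;> rcases h2 with h2 | h2 <;> simp_all

theorem card_benderKnuth (h : IsSkew row col) (hT : IsSemistd row col T) (i : Fin n) :
    (Finset.univ.filter fun x => col x < j ∧ benderKnuth row col j a b T x = i).card =
      (Finset.univ.filter fun x => col x < j ∧ T x = Equiv.swap a b i).card := by
  classical
  have hB := bandInvolution_band (j := j) (a := a) (b := b) h hT
  by_cases hi : i = a ∨ i = b
  · have hs : Equiv.swap a b i = a ∨ Equiv.swap a b i = b := by
      rcases hi with rfl | rfl <;> simp
    refine Finset.card_bij' (fun x _ => bandInvolution row col (band col j a b T) x)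
      (fun x _ => bandInvolution row col (band col j a b T) x) ?_ ?_ ?_ ?_
    all_goals
      intro x hx
      simp only [Finset.mem_filter, Finset.mem_univ, true_and] at hx ⊢
    · have hxb : x ∈ band col j a b T := by
        rw [← band_benderKnuth h hT, mem_band, hx.2]; exact ⟨hx.1, hi⟩
      refine ⟨(mem_band.1 (hB.mem x hxb)).1, ?_⟩
      rw [← hx.2, benderKnuth_of_mem hxb, Equiv.swap_apply_self]
    · have hxb : x ∈ band col j a b T := by
        rw [mem_band, hx.2]; exact ⟨hx.1, hs⟩
      refine ⟨(mem_band.1 (hB.mem x hxb)).1, ?_⟩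
      rw [benderKnuth_of_mem (hB.mem x hxb), hB.invol x hxb, hx.2, Equiv.swap_apply_self]
    · exact hB.invol x (by rw [← band_benderKnuth h hT, mem_band, hx.2]; exact ⟨hx.1, hi⟩)
    · exact hB.invol x (by rw [mem_band, hx.2]; exact ⟨hx.1, hs⟩)
  · push Not at hi
    rw [Equiv.swap_apply_of_ne_of_ne hi.1 hi.2]
    congr 1
    ext x
    simp only [Finset.mem_filter, Finset.mem_univ, true_and, and_congr_right_iff]
    intro hxj
    by_cases hx : x ∈ band col j a b T
    · have h1 := benderKnuth_mem_pair h hT hx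
      have h2 := (mem_band.1 hx).2
      grind
    · rw [benderKnuth_of_notMem hx]

theorem benderKnuth_isSemistd (h : IsSkew row col) (hT : IsSemistd row col T)
    (hab : (a : ℕ) + 1 = b) (hj : ∀ x, col x = j → T x ≠ a) :
    IsSemistd row col (benderKnuth row col j a b T) := by
  have hB := bandInvolution_band (j := j) (a := a) (b := b) h hT
  have hlt : a < b := by rw [Fin.lt_def]; omega
  have pair_le : ∀ u v : Fin n, (u = a ∨ u = b) → (v = a ∨ v = b) → u = a ∨ v = b → u ≤ v := by
    rintro u v (rfl | rfl) (rfl | rfl) h <;> first | exact le_rfl | exact hlt.le | grind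
  constructor
  · intro x y hr hc
    have hle := hT.row_weak x y hr hc
    by_cases hx : x ∈ band col j a b T <;> by_cases hy : y ∈ band col j a b T
    · have hx' := mem_band.1 hx
      have hy' := mem_band.1 hy
      have hbx := benderKnuth_mem_pair h hT hx
      have hby := benderKnuth_mem_pair h hT hy
      by_cases hax : AloneInCol col (band col j a b T) x <;>
        by_cases hay : AloneInCol col (band col j a b T) y
      · have hle' := hT.row_weak _ _
          (((hB.alone_row y hy hay).trans hr.symm).trans (hB.alone_row x hx hax).symm)
          (hB.alone_anti x hx y hy hax hay hr hc)
        rw [benderKnuth_of_mem hx, benderKnuth_of_mem hy]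
        rcases (mem_band.1 (hB.mem x hx)).2 with h1 | h1 <;>
          rcases (mem_band.1 (hB.mem y hy)).2 with h2 | h2 <;>
          rw [h1, h2] at hle' ⊢ <;> simp [hlt.le] at hle' ⊢
        omega
      · rw [benderKnuth_of_not_alone h hT hy hay]
        refine pair_le _ _ hbx hy'.2 (Or.inr ?_)
        by_contra hyb
        have hya : T y = a := hy'.2.resolve_right hyb
        simp only [AloneInCol, not_forall] at hay
        obtain ⟨z, hz, hzc, hzy⟩ := hay
        have hz' := mem_band.1 hz
        have hrz : row y < row z := by
          rcases lt_trichotomy (row y) (row z) with h1 | h1 | h1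
          · exact h1
          · exact absurd (h.inj _ _ h1.symm hzc) hzy
          · have := hT.col_strict _ _ hzc h1
            grind
        obtain ⟨w, hw1, hw2⟩ := h.convex x z (row z) (col x) (by omega) le_rfl le_rfl (by omega)
        have h1 := hT.row_weak w z hw1 (by omega)
        have h2 := hT.col_strict x w hw2.symm (by omega)
        have hw : w ∈ band col j a b T := by
          refine mem_band.2 ⟨by omega, ?_⟩
          rw [Fin.le_def] at h1
          rw [Fin.lt_def] at h2
          grind
        have := hax w hw hw2
        grind
      · rw [benderKnuth_of_not_alone h hT hx hax]
        refine pair_le _ _ hx'.2 hby (Or.inl ?_)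
        by_contra hxa
        have hxb : T x = b := hx'.2.resolve_left hxa
        simp only [AloneInCol, not_forall] at hax
        obtain ⟨z, hz, hzc, hzx⟩ := hax
        have hz' := mem_band.1 hz
        have hrz : row z < row x := by
          rcases lt_trichotomy (row z) (row x) with h1 | h1 | h1
          · exact h1
          · exact absurd (h.inj _ _ h1 hzc) hzx
          · have := hT.col_strict _ _ hzc.symm h1
            grind
        obtain ⟨w, hw1, hw2⟩ := h.convex z y (row z) (col y) le_rfl (by omega) (by omega) le_rfl
        have h1 := hT.row_weak z w hw1.symm (by omega)
        have h2 := hT.col_strict w y hw2 (by omega)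
        have hw : w ∈ band col j a b T := by
          refine mem_band.2 ⟨by omega, ?_⟩
          rw [Fin.le_def] at h1
          rw [Fin.lt_def] at h2
          grind
        have := hay w hw hw2
        grind
      · rwa [benderKnuth_of_not_alone h hT hx hax, benderKnuth_of_not_alone h hT hy hay]
    · rw [benderKnuth_of_notMem hy]
      have hx' := mem_band.1 hx
      have hbx := benderKnuth_mem_pair h hT hx
      have hya : T y ≠ a := by
        intro hya
        rcases lt_or_ge (col y) j with h1 | h1
        · exact hy (mem_band.2 ⟨h1, Or.inl hya⟩)
        · obtain ⟨z, hz1, hz2⟩ := h.convex x y (row x) j le_rfl (by omega) (by omega) h1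
          have h2 := hT.row_weak x z hz1.symm (by omega)
          have h3 := hT.row_weak z y (by omega) (by omega)
          have := hj z hz2
          grind
      have : T y ≥ b := by grind
      rcases hbx with h1 | h1 <;> rw [h1] <;> grind
    · rw [benderKnuth_of_notMem hx]
      have hy' := mem_band.1 hy
      have hby := benderKnuth_mem_pair h hT hy
      have hx1 : ¬ (T x = a ∨ T x = b) := fun h1 => hx (mem_band.2 ⟨by omega, h1⟩)
      rcases hby with h1 | h1 <;> rw [h1] <;> grind
    · rwa [benderKnuth_of_notMem hx, benderKnuth_of_notMem hy]
  · intro x y hc hr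
    have hl := hT.col_strict x y hc hr
    by_cases hx : x ∈ band col j a b T <;> by_cases hy : y ∈ band col j a b T
    · have hxy : x ≠ y := by rintro rfl; omega
      rw [benderKnuth_of_not_alone h hT hx fun ha => hxy (ha y hy hc.symm).symm,
        benderKnuth_of_not_alone h hT hy fun ha => hxy (ha x hx hc)]
      exact hl
    · rw [benderKnuth_of_notMem hy]
      have hx' := mem_band.1 hx
      have hbx := benderKnuth_mem_pair h hT hx
      have hy1 : ¬ (T y = a ∨ T y = b) := fun h1 => hy (mem_band.2 ⟨by omega, h1⟩)
      rcases hbx with h1 | h1 <;> rw [h1] <;> grind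
    · rw [benderKnuth_of_notMem hx]
      have hy' := mem_band.1 hy
      have hby := benderKnuth_mem_pair h hT hy
      have hx1 : ¬ (T x = a ∨ T x = b) := fun h1 => hx (mem_band.2 ⟨by omega, h1⟩)
      rcases hby with h1 | h1 <;> rw [h1] <;> grind
    · rwa [benderKnuth_of_notMem hx, benderKnuth_of_notMem hy]

end BenderKnuth

section Alternation

variable {n : ℕ}

/-- The alternating indicator: the sign of the permutation carrying `w` to `v`, or `0`. -/
def altIndicator (w v : Fin n → ℕ) : ℤ :=
  (Matrix.of fun i j => if v i = w j then (1 : ℤ) else 0).det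

theorem altIndicator_swap (w v : Fin n → ℕ) {a b : Fin n} (hab : a ≠ b) :
    altIndicator w (v ∘ Equiv.swap a b) = - altIndicator w v := by
  have := Matrix.det_permute (Equiv.swap a b)
    (Matrix.of fun i j => if v i = w j then (1 : ℤ) else 0)
  rw [Equiv.Perm.sign_swap hab] at this
  simpa [altIndicator, Matrix.submatrix] using this

theorem altIndicator_strictAnti {w v : Fin n → ℕ} (hw : StrictAnti w) (hv : StrictAnti v) :
    altIndicator w v = if v = w then 1 else 0 := by
  split_ifs with h
  · subst h
    have : (Matrix.of fun i j => if v i = v j then (1 : ℤ) else 0) = 1 := by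
      ext i j
      simp [Matrix.one_apply, hv.injective.eq_iff]
    rw [altIndicator, this, Matrix.det_one]
  · obtain ⟨i, hi⟩ : ∃ i, ∀ j, v i ≠ w j := by
      by_contra! hc
      refine h ?_
      have hr : Set.range v = Set.range w := by
        have hsub : Finset.univ.image v ⊆ Finset.univ.image w := by
          intro x hx
          simp only [Finset.mem_image, Finset.mem_univ, true_and] at hx ⊢
          obtain ⟨i, rfl⟩ := hx
          obtain ⟨j, hj⟩ := hc i
          exact ⟨j, hj.symm⟩
        have := Finset.eq_of_subset_of_card_le hsub (by
          rw [Finset.card_image_of_injective _ hv.injective,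
            Finset.card_image_of_injective _ hw.injective])
        simpa [Finset.ext_iff, Set.ext_iff] using this
      exact (StrictAnti.range_inj hv hw).1 hr
    exact Matrix.det_eq_zero_of_row_eq_zero i fun j => by simp [hi j]

end Alternation

section Counting

variable {X : Type*} [Fintype X] {n : ℕ} {row col : X → ℤ}

theorem exists_col_bound (col : X → ℤ) : ∃ j, ∀ x, col x < j := by
  obtain ⟨M, hM⟩ := (Set.finite_range col).bddAbove
  exact ⟨M + 1, fun x => Int.lt_add_one_of_le (hM ⟨x, rfl⟩)⟩

theorem wt_eq_add_colWt (T : X → Fin n) (j : ℤ) (i : Fin n) :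
    wt T i = (Finset.univ.filter fun x => col x < j ∧ T x = i).card + colWt col T j i := by
  classical
  rw [wt, colWt, ← Finset.card_filter_add_card_filter_not (fun x => col x < j),
    Finset.filter_filter, Finset.filter_filter]
  congr 2 <;> ext x <;> simp [and_comm]

theorem colWt_benderKnuth {j j' : ℤ} (hj : j ≤ j') (a b : Fin n) (T : X → Fin n) :
    colWt col (benderKnuth row col j a b T) j' = colWt col T j' := by
  ext i
  rw [colWt, colWt]
  congr 1
  ext x
  simp only [Finset.mem_filter, Finset.mem_univ, true_and, and_congr_right_iff]
  intro hx
  rw [benderKnuth_of_le (hj.trans hx)]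

open Classical in
theorem sum_wt_swap (h : IsSkew row col) (f : (Fin n → ℕ) → ℤ) {a b : Fin n}
    (hab : (a : ℕ) + 1 = b) :
    ∑ T : X → Fin n with IsSemistd row col T, f (wt T ∘ Equiv.swap a b) =
      ∑ T : X → Fin n with IsSemistd row col T, f (wt T) := by
  obtain ⟨j, hj⟩ := exists_col_bound col
  have hj' : ∀ (T : X → Fin n) (x : X), col x = j → T x ≠ a := fun T x hx =>
    absurd hx (hj x).ne
  refine Finset.sum_bij' (fun T _ => benderKnuth row col j a b T)
    (fun T _ => benderKnuth row col j a b T) ?_ ?_ ?_ ?_ ?_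
  all_goals
    intro T hT
    simp only [Finset.mem_filter, Finset.mem_univ, true_and] at hT ⊢
  · exact benderKnuth_isSemistd h hT hab (hj' T)
  · exact benderKnuth_isSemistd h hT hab (hj' T)
  · exact benderKnuth_benderKnuth h hT
  · exact benderKnuth_benderKnuth h hT
  · congr 1
    ext i
    have := card_benderKnuth (j := j) (a := a) (b := b) h hT i
    simpa [wt, hj] using this.symm

open Classical in
theorem sum_wt_perm (h : IsSkew row col) (f : (Fin n → ℕ) → ℤ) (σ : Equiv.Perm (Fin n)) :
    ∑ T : X → Fin n with IsSemistd row col T, f (wt T ∘ σ) =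
      ∑ T : X → Fin n with IsSemistd row col T, f (wt T) := by
  cases n with
  | zero => simp [Subsingleton.elim σ 1]
  | succ n =>
    have hσ : σ ∈ Submonoid.closure
        (Set.range fun i : Fin n => Equiv.swap i.castSucc i.succ) := by
      rw [Equiv.Perm.mclosure_swap_castSucc_succ]
      trivial
    induction hσ using Submonoid.closure_induction generalizing f with
    | mem σ hσ =>
      obtain ⟨i, rfl⟩ := hσ
      exact sum_wt_swap h f (by simp)
    | one => simp
    | mul σ τ _ _ ih1 ih2 =>
      have := ih1 (fun v => f (v ∘ τ))
      simp only [Equiv.Perm.coe_mul, ← Function.comp_assoc]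
      rw [this, ih2]

/-- The staircase shift making partitions strictly decreasing. -/
def staircase (n : ℕ) (i : Fin n) : ℕ := n - i

theorem staircase_add_strictAnti {v : Fin n → ℕ}
    (hv : ∀ a b : Fin n, (a : ℕ) + 1 = b → v b ≤ v a) : StrictAnti (v + staircase n) := by
  cases n with
  | zero => exact fun i => i.elim0
  | succ n =>
    refine Fin.strictAnti_iff_succ_lt.2 fun i => ?_
    have := hv i.castSucc i.succ (by simp)
    simp only [Pi.add_apply, staircase, Fin.val_succ, Fin.val_castSucc]
    omega

theorem colWt_of_forall_le {j : ℤ} (hj : ∀ x, j ≤ col x) (T : X → Fin n) :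
    colWt col T j = wt T := by
  ext i
  simp [colWt, wt, hj]

theorem IsLattice.wt_le {T : X → Fin n} (hT : IsLattice col T) {a b : Fin n}
    (hab : (a : ℕ) + 1 = b) : wt T b ≤ wt T a := by
  obtain ⟨j, hj⟩ := exists_col_bound (-col)
  have hj' : ∀ x, -j ≤ col x := fun x => by have := hj x; simp at this; omega
  rw [← colWt_of_forall_le hj']
  exact hT _ _ _ hab

/-- The letters `a`, `b` are adjacent and violate the lattice condition for the weight `v`. -/
def IsDescentPair (v : Fin n → ℕ) (p : Fin n × Fin n) : Prop :=
  (p.1 : ℕ) + 1 = p.2 ∧ v p.1 < v p.2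

/-- The lattice condition fails at column `j`, and at no later column. -/
def IsLastFailure (col : X → ℤ) (T : X → Fin n) (j : ℤ) : Prop :=
  (∃ p, IsDescentPair (colWt col T j) p) ∧
    ∀ j' > j, ∀ p, ¬ IsDescentPair (colWt col T j') p

theorem exists_isLastFailure {T : X → Fin n} (hT : ¬ IsLattice col T) :
    ∃ j, IsLastFailure col T j := by
  obtain ⟨M, hM⟩ := exists_col_bound col
  simp only [IsLattice, not_forall, not_le] at hT
  obtain ⟨j₀, a, b, hab, hlt⟩ := hT
  obtain ⟨j, hj1, hj2⟩ := Int.exists_greatest_of_bdd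
    (P := fun j => ∃ p, IsDescentPair (colWt col T j) p) ⟨M, fun j hj => by
      obtain ⟨p, -, hp⟩ := hj
      by_contra hMj
      have : colWt col T j p.2 = 0 := by
        rw [colWt, Finset.card_eq_zero, Finset.filter_eq_empty_iff]
        intro x _ hx
        have := hM x
        omega
      omega⟩ ⟨j₀, (a, b), hab, hlt⟩
  exact ⟨j, hj1, fun j' hj' p hp => by have := hj2 j' ⟨p, hp⟩; omega⟩

theorem IsLastFailure.unique {T : X → Fin n} {j j' : ℤ} (h : IsLastFailure col T j)
    (h' : IsLastFailure col T j') : j = j' := by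
  obtain ⟨p, hp⟩ := h.1
  obtain ⟨p', hp'⟩ := h'.1
  rcases lt_trichotomy j j' with hj | hj | hj
  · exact absurd hp' (h.2 _ hj p')
  · exact hj
  · exact absurd hp (h'.2 _ hj p)

/-- A violating pair of letters, depending only on the weight. -/
noncomputable def descentPair (v : Fin n → ℕ) (hv : ∃ p, IsDescentPair v p) : Fin n × Fin n :=
  hv.choose

theorem descentPair_congr {v v' : Fin n → ℕ} (h : v = v') (hv : ∃ p, IsDescentPair v p)
    (hv' : ∃ p, IsDescentPair v' p) : descentPair v hv = descentPair v' hv' := by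
  subst h
  rfl

theorem card_colWt_succ (T : X → Fin n) (j : ℤ) (i : Fin n) :
    colWt col T j i =
      (Finset.univ.filter fun x => col x = j ∧ T x = i).card + colWt col T (j + 1) i := by
  classical
  rw [colWt, colWt, ← Finset.card_filter_add_card_filter_not (fun x => col x = j),
    Finset.filter_filter, Finset.filter_filter]
  congr 2 <;> ext x <;> simp only [Finset.mem_filter, Finset.mem_univ, true_and] <;> grind

theorem card_col_le_one (h : IsSkew row col) {T : X → Fin n} (hT : IsSemistd row col T) (j : ℤ)
    (i : Fin n) : (Finset.univ.filter fun x => col x = j ∧ T x = i).card ≤ 1 := by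
  rw [Finset.card_le_one]
  intro x hx y hy
  simp only [Finset.mem_filter, Finset.mem_univ, true_and] at hx hy
  have hc : col x = col y := hx.1.trans hy.1.symm
  rcases lt_trichotomy (row x) (row y) with h1 | h1 | h1
  · have := hT.col_strict _ _ hc h1
    grind
  · exact h.inj _ _ h1 hc
  · have := hT.col_strict _ _ hc.symm h1
    grind

theorem IsLastFailure.colWt_eq (h : IsSkew row col) {T : X → Fin n} (hT : IsSemistd row col T)
    {j : ℤ} (hj : IsLastFailure col T j) {p : Fin n × Fin n}
    (hp : IsDescentPair (colWt col T j) p) :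
    colWt col T j p.2 = colWt col T j p.1 + 1 ∧ ∀ x, col x = j → T x ≠ p.1 := by
  have h1 := card_colWt_succ (col := col) T j p.1
  have h2 := card_colWt_succ (col := col) T j p.2
  have h3 := card_col_le_one h hT j p.2
  have h4 := hj.2 (j + 1) (by omega) p
  have h5 := hp.2
  simp only [IsDescentPair, hp.1, true_and] at h4
  have h6 : (Finset.univ.filter fun x => col x = j ∧ T x = p.1).card = 0 := by omega
  refine ⟨by omega, fun x hx hx' => ?_⟩
  rw [Finset.card_eq_zero, Finset.filter_eq_empty_iff] at h6
  exact h6 (Finset.mem_univ x) ⟨hx, hx'⟩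

/-- Apply the Bender–Knuth involution to the left of the last column violating the lattice
condition. -/
noncomputable def signReversing (row col : X → ℤ) (T : X → Fin n) (hT : ¬ IsLattice col T) :
    X → Fin n :=
  have hj := (exists_isLastFailure hT).choose_spec
  benderKnuth row col (exists_isLastFailure hT).choose
    (descentPair _ hj.1).1 (descentPair _ hj.1).2 T

theorem signReversing_eq {T : X → Fin n} (hT : ¬ IsLattice col T) {j : ℤ}
    (hj : IsLastFailure col T j) :
    signReversing row col T hT =
      benderKnuth row col j (descentPair _ hj.1).1 (descentPair _ hj.1).2 T := by
  have : (exists_isLastFailure hT).choose = j :=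
    (exists_isLastFailure hT).choose_spec.unique hj
  subst this
  rfl

theorem isLastFailure_benderKnuth {T : X → Fin n} {j : ℤ} (hj : IsLastFailure col T j)
    (a b : Fin n) : IsLastFailure col (benderKnuth row col j a b T) j := by
  refine ⟨by rw [colWt_benderKnuth le_rfl]; exact hj.1, fun j' hj' => ?_⟩
  rw [colWt_benderKnuth hj'.le]
  exact hj.2 j' hj'

theorem IsLastFailure.not_isLattice {T : X → Fin n} {j : ℤ} (hj : IsLastFailure col T j) :
    ¬ IsLattice col T := by
  obtain ⟨p, hp1, hp2⟩ := hj.1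
  exact fun hT => absurd (hT j p.1 p.2 hp1) (by omega)

theorem altIndicator_benderKnuth (h : IsSkew row col) {T : X → Fin n}
    (hT : IsSemistd row col T) {j : ℤ} (hj : IsLastFailure col T j) {p : Fin n × Fin n}
    (hp : IsDescentPair (colWt col T j) p) (w : Fin n → ℕ) :
    altIndicator w (wt (benderKnuth row col j p.1 p.2 T) + staircase n) =
      - altIndicator w (wt T + staircase n) := by
  have hne : p.1 ≠ p.2 := by
    intro he
    have := hp.1
    rw [he] at this
    omega
  rw [← altIndicator_swap w _ hne]
  congr 1
  ext i
  have h1 := (hj.colWt_eq h hT hp).1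
  simp only [Pi.add_apply, Function.comp_apply]
  rw [wt_eq_add_colWt (col := col) _ j i, wt_eq_add_colWt (col := col) T j (Equiv.swap p.1 p.2 i),
    card_benderKnuth h hT, colWt_benderKnuth le_rfl]
  have h2 := hp.1
  have h3 := p.2.isLt
  by_cases hi1 : i = p.1
  · subst hi1
    simp only [Equiv.swap_apply_left, staircase]
    omega
  · by_cases hi2 : i = p.2
    · subst hi2
      simp only [Equiv.swap_apply_right, staircase]
      omega
    · rw [Equiv.swap_apply_of_ne_of_ne hi1 hi2]

open Classical in
/-- The number of lattice semistandard fillings of content `w`. -/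
noncomputable def latticeCount (row col : X → ℤ) (w : Fin n → ℕ) : ℕ :=
  (Finset.univ.filter fun T : X → Fin n => (IsSemistd row col T ∧ IsLattice col T) ∧ wt T = w).card

theorem latticeCount_eq_natCard (w : Fin n → ℕ) : latticeCount row col w =
    Nat.card {T : X → Fin n // (IsSemistd row col T ∧ IsLattice col T) ∧ wt T = w} := by
  classical
  rw [Nat.card_eq_fintype_card, Fintype.card_subtype, latticeCount]

open Classical in
theorem latticeCount_eq_sum (h : IsSkew row col) {w : Fin n → ℕ}
    (hw : ∀ a b : Fin n, (a : ℕ) + 1 = b → w b ≤ w a) :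
    (latticeCount row col w : ℤ) =
      ∑ T : X → Fin n with IsSemistd row col T,
        altIndicator (w + staircase n) (wt T + staircase n) := by
  rw [← Finset.sum_filter_add_sum_filter_not _ (fun T => IsLattice col T)]
  have h0 : ∑ T : X → Fin n with IsSemistd row col T ∧ ¬ IsLattice col T,
      altIndicator (w + staircase n) (wt T + staircase n) = 0 := by
    refine Finset.sum_involution
      (fun T hT => signReversing row col T (Finset.mem_filter.1 hT).2.2) ?_ ?_ ?_ ?_
    all_goals
      intro T hT
      obtain ⟨hT1, hT2⟩ := (Finset.mem_filter.1 hT).2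
      obtain ⟨j, hj⟩ := exists_isLastFailure hT2
      have hp : IsDescentPair (colWt col T j) (descentPair _ hj.1) := hj.1.choose_spec
    · rw [signReversing_eq hT2 hj, altIndicator_benderKnuth h hT1 hj hp]
      ring
    · intro hne he
      have := altIndicator_benderKnuth h hT1 hj hp (w + staircase n)
      rw [← signReversing_eq hT2 hj, he] at this
      omega
    · rw [signReversing_eq hT2 hj]
      simp only [Finset.mem_filter, Finset.mem_univ, true_and]
      exact ⟨benderKnuth_isSemistd h hT1 hp.1 (hj.colWt_eq h hT1 hp).2,
        (isLastFailure_benderKnuth hj _ _).not_isLattice⟩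
    · have he := signReversing_eq (row := row) hT2 hj
      generalize_proofs at he ⊢
      generalize signReversing row col T _ = T' at *
      subst he
      rw [signReversing_eq _ (isLastFailure_benderKnuth hj _ _)]
      rw [descentPair_congr (colWt_benderKnuth le_rfl _ _ T) _ hj.1]
      exact benderKnuth_benderKnuth h hT1
  rw [Finset.filter_filter, Finset.filter_filter, h0, add_zero, latticeCount,
    ← Finset.filter_filter, Finset.card_filter, Nat.cast_sum]
  refine Finset.sum_congr rfl fun T hT => ?_
  simp only [Finset.mem_filter, Finset.mem_univ, true_and] at hT
  rw [altIndicator_strictAnti (staircase_add_strictAnti hw)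
    (staircase_add_strictAnti fun a b hab => hT.2.wt_le hab)]
  simp

omit [Fintype X] in
theorem isSemistd_neg_rev {T : X → Fin n} :
    IsSemistd (-row) (-col) (Fin.rev ∘ T) ↔ IsSemistd row col T := by
  constructor
  · intro hT
    refine ⟨fun x y h1 h2 => ?_, fun x y h1 h2 => ?_⟩
    · simpa using hT.row_weak y x (by simp [h1]) (by simpa using h2)
    · simpa using hT.col_strict y x (by simp [h1]) (by simpa using h2)
  · intro hT
    refine ⟨fun x y h1 h2 => ?_, fun x y h1 h2 => ?_⟩
    · simpa using hT.row_weak y x (by simpa using h1.symm) (by simpa using h2)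
    · simpa using hT.col_strict y x (by simpa using h1.symm) (by simpa using h2)

/-- Rotating a diagram by a half turn does not change its lattice counts. -/
theorem latticeCount_neg (h : IsSkew row col) {w : Fin n → ℕ}
    (hw : ∀ a b : Fin n, (a : ℕ) + 1 = b → w b ≤ w a) :
    latticeCount (-row) (-col) w = latticeCount row col w := by
  classical
  have : (latticeCount (-row) (-col) w : ℤ) = latticeCount row col w := by
    rw [latticeCount_eq_sum h.neg hw, latticeCount_eq_sum h hw,
      ← sum_wt_perm h (fun v => altIndicator (w + staircase n) (v + staircase n)) Fin.revPerm]
    refine Finset.sum_bij' (fun T _ => Fin.rev ∘ T) (fun T _ => Fin.rev ∘ T) ?_ ?_ ?_ ?_ ?_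
    · intro T hT
      simp only [Finset.mem_filter, Finset.mem_univ, true_and] at hT ⊢
      rw [← isSemistd_neg_rev]
      simpa [Function.comp_def] using hT
    · intro T hT
      simp only [Finset.mem_filter, Finset.mem_univ, true_and] at hT ⊢
      rwa [isSemistd_neg_rev]
    · intro T _
      ext x; simp
    · intro T _
      ext x; simp
    · intro T _
      congr 2
      ext i
      simp [wt]
  exact_mod_cast this

end Counting

section LetterRank

variable {X : Type*} [Fintype X] {n : ℕ} {row col : X → ℤ} {T : X → Fin n}

omit [Fintype X] in
theorem IsSemistd.eq_of_col_eq (h : IsSkew row col) (hT : IsSemistd row col T) {x y : X}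
    (hxy : T x = T y) (hc : col x = col y) : x = y := by
  rcases lt_trichotomy (row x) (row y) with h1 | h1 | h1
  · exact absurd hxy (hT.col_strict _ _ hc h1).ne
  · exact h.inj _ _ h1 hc
  · exact absurd hxy (hT.col_strict _ _ hc.symm h1).ne'

omit [Fintype X] in
/-- Cells weakly to the south-east have weakly larger entries, strictly if they are lower. -/
theorem IsSemistd.lt_of_row_lt (h : IsSkew row col) (hT : IsSemistd row col T) {x y : X}
    (hr : row x < row y) (hc : col x ≤ col y) : T x < T y := by
  obtain ⟨z, hz1, hz2⟩ := h.convex x y (row y) (col x) hr.le le_rfl le_rfl hc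
  exact (hT.col_strict x z hz2.symm (by omega)).trans_le (hT.row_weak z y hz1 (by omega))

theorem IsLattice.colWt_antitone (hL : IsLattice col T) (j : ℤ) : Antitone (colWt col T j) := by
  cases n with
  | zero => exact fun i => i.elim0
  | succ n => exact Fin.antitone_iff_succ_le.2 fun i => hL j _ _ (by simp)

theorem IsLattice.wt_antitone (hL : IsLattice col T) : Antitone (wt T) := by
  cases n with
  | zero => exact fun i => i.elim0
  | succ n => exact Fin.antitone_iff_succ_le.2 fun i => hL.wt_le (by simp)

/-- The number of entries equal to `T x` to the right of `x`. -/
def letterRank (col : X → ℤ) (T : X → Fin n) (x : X) : ℕ :=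
  (Finset.univ.filter fun y => T y = T x ∧ col x < col y).card

theorem letterRank_lt_wt (x : X) : letterRank col T x < wt T (T x) := by
  refine Finset.card_lt_card ⟨?_, fun hs => ?_⟩
  · intro y
    simp +contextual
  · have := hs (show x ∈ _ by simp)
    simp at this

theorem letterRank_lt {x y : X} (hxy : T x = T y) (hc : col x < col y) :
    letterRank col T y < letterRank col T x := by
  refine Finset.card_lt_card ⟨?_, fun hs => ?_⟩
  · intro z
    simp only [Finset.mem_filter, Finset.mem_univ, true_and]
    exact fun hz => ⟨hz.1.trans hxy.symm, hc.trans hz.2⟩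
  · have := hs (show y ∈ _ by simp [hxy, hc])
    simp at this

theorem letterRank_inj (h : IsSkew row col) (hT : IsSemistd row col T) {x y : X}
    (hxy : T x = T y) (hr : letterRank col T x = letterRank col T y) : x = y := by
  rcases lt_trichotomy (col x) (col y) with h1 | h1 | h1
  · have := letterRank_lt hxy h1
    omega
  · exact hT.eq_of_col_eq h hxy h1
  · have := letterRank_lt hxy.symm h1
    omega

theorem exists_letterRank_eq (h : IsSkew row col) (hT : IsSemistd row col T) {a : Fin n} {i : ℕ}
    (hi : i < wt T a) : ∃ x, T x = a ∧ letterRank col T x = i := by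
  classical
  have him : ((Finset.univ.filter fun x => T x = a).image (letterRank col T)) =
      Finset.range (wt T a) := by
    refine Finset.eq_of_subset_of_card_le ?_ ?_
    · intro k hk
      simp only [Finset.mem_image, Finset.mem_filter, Finset.mem_univ, true_and] at hk
      obtain ⟨x, rfl, rfl⟩ := hk
      exact Finset.mem_range.2 (letterRank_lt_wt x)
    · rw [Finset.card_range, Finset.card_image_of_injOn, wt]
      intro x hx y hy hxy
      simp only [Finset.coe_filter, Finset.mem_univ, true_and, Set.mem_ofPred_eq] at hx hy
      exact letterRank_inj h hT (hx.trans hy.symm) hxy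
  have := Finset.mem_range.2 hi
  rw [← him] at this
  simpa using this

theorem colWt_col_eq (h : IsSkew row col) (hT : IsSemistd row col T) (x : X) :
    colWt col T (col x) (T x) = letterRank col T x + 1 := by
  classical
  rw [colWt, letterRank, ← Finset.card_insert_of_notMem (a := x) (by simp)]
  congr 1
  ext y
  simp only [Finset.mem_filter, Finset.mem_univ, true_and, Finset.mem_insert]
  constructor
  · rintro ⟨h1, h2⟩
    rcases h1.eq_or_lt with h1 | h1
    · exact Or.inl (hT.eq_of_col_eq h h2 h1.symm)
    · exact Or.inr ⟨h2, h1⟩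
  · rintro (rfl | ⟨h1, h2⟩)
    · simp
    · exact ⟨h2.le, h1⟩

theorem le_col_of_letterRank_lt {j : ℤ} {y : X} (hy : letterRank col T y < colWt col T j (T y)) :
    j ≤ col y := by
  by_contra! hj
  refine hy.not_ge (Finset.card_le_card fun z => ?_)
  simp only [Finset.mem_filter, Finset.mem_univ, true_and]
  exact fun hz => ⟨hz.2, by omega⟩

theorem IsLattice.col_le_col (h : IsSkew row col) (hT : IsSemistd row col T)
    (hL : IsLattice col T) {x y : X} (hxy : T y < T x)
    (hr : letterRank col T y ≤ letterRank col T x) : col x ≤ col y := by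
  refine le_col_of_letterRank_lt (T := T) ?_
  have h1 := hL.colWt_antitone (col x) hxy.le
  have h2 := colWt_col_eq h hT x
  omega

/-- The filling of the transposed and rotated diagram by the ranks of the letters. -/
def rankFilling (col : X → ℤ) (T : X → Fin n) {m : ℕ} (hm : ∀ a, wt T a ≤ m) (x : X) : Fin m :=
  ⟨letterRank col T x, (letterRank_lt_wt x).trans_le (hm _)⟩

variable {m : ℕ} (hm : ∀ a, wt T a ≤ m)

include hm in
theorem rankFilling_isSemistd (h : IsSkew row col) (hT : IsSemistd row col T)
    (hL : IsLattice col T) : IsSemistd (-col) (-row) (rankFilling col T hm) := by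
  constructor
  · intro x y hc hr
    simp only [Pi.neg_apply, neg_inj, neg_le_neg_iff] at hc hr
    rw [Fin.le_def]
    rcases hr.eq_or_lt with h1 | h1
    · rw [h.inj x y h1.symm hc]
    · have h2 := hL.colWt_antitone (col x) (hT.col_strict y x hc.symm h1).le
      have h3 := colWt_col_eq h hT x
      have h4 := colWt_col_eq h hT y
      rw [← hc] at h4
      simp only [rankFilling]
      omega
  · intro x y hr hc
    simp only [Pi.neg_apply, neg_inj, neg_lt_neg_iff] at hc hr
    rw [Fin.lt_def]
    simp only [rankFilling]
    rcases (hT.row_weak y x hr.symm hc.le).eq_or_lt with h1 | h1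
    · exact letterRank_lt h1 hc
    · by_contra! h2
      have := hL.col_le_col h hT h1 h2
      omega

include hm in
theorem rankFilling_isLattice (h : IsSkew row col) (hT : IsSemistd row col T) :
    IsLattice (-row) (rankFilling col T hm) := by
  intro j a b hab
  have hpred : ∀ x, ∃ y, letterRank col T x = b → T y = T x ∧ letterRank col T y = a := by
    intro x
    by_cases hx : letterRank col T x = b
    · obtain ⟨y, hy⟩ := exists_letterRank_eq h hT (a := T x) (i := a)
        (by have := letterRank_lt_wt (col := col) (T := T) x; omega)
      exact ⟨y, fun _ => hy⟩
    · exact ⟨x, fun h => absurd h hx⟩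
  choose pred hp using hpred
  refine Finset.card_le_card_of_injOn pred ?_ ?_
  · intro x hx
    simp only [Finset.coe_filter, Finset.mem_univ, true_and, Set.mem_ofPred_eq, Pi.neg_apply,
      rankFilling, Fin.ext_iff] at hx ⊢
    obtain ⟨h1, h2⟩ := hp x hx.2
    refine ⟨?_, h2⟩
    have hc : col x < col (pred x) := by
      by_contra! hc
      rcases hc.eq_or_lt with hc | hc
      · have h3 := hT.eq_of_col_eq h h1 hc
        rw [h3] at h2
        omega
      · have := letterRank_lt h1 hc
        omega
    have : row (pred x) ≤ row x := by
      by_contra! hr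
      exact absurd h1 (hT.lt_of_row_lt h hr hc.le).ne'
    omega
  · intro x hx y hy hxy
    simp only [Finset.coe_filter, Finset.mem_univ, true_and, Set.mem_ofPred_eq,
      rankFilling, Fin.ext_iff] at hx hy
    refine letterRank_inj h hT ?_ (hx.2.trans hy.2.symm)
    rw [← (hp x hx.2).1, ← (hp y hy.2).1, hxy]

theorem wt_rankFilling (h : IsSkew row col) (hT : IsSemistd row col T) (i : Fin m) :
    wt (rankFilling col T hm) i = (Finset.univ.filter fun a => (i : ℕ) < wt T a).card := by
  refine Finset.card_bij (fun x _ => T x) ?_ ?_ ?_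
  · intro x hx
    simp only [Finset.mem_filter, Finset.mem_univ, true_and] at hx ⊢
    rw [← hx]
    exact letterRank_lt_wt x
  · intro x hx y hy hxy
    simp only [Finset.mem_filter, Finset.mem_univ, true_and] at hx hy
    exact letterRank_inj h hT hxy (by simpa [rankFilling] using hx.trans hy.symm)
  · intro a ha
    simp only [Finset.mem_filter, Finset.mem_univ, true_and] at ha
    obtain ⟨x, hx1, hx2⟩ := exists_letterRank_eq h hT ha
    exact ⟨x, by simp [rankFilling, Fin.ext_iff, hx2], hx1⟩

/-- A lattice filling is determined by its ranks. -/
theorem card_rank_eq_letter (h : IsSkew row col) (hT : IsSemistd row col T)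
    (hL : IsLattice col T) (x : X) :
    (Finset.univ.filter fun y => letterRank col T y = letterRank col T x ∧
      (col x < col y ∨ col x = col y ∧ row y < row x)).card = T x := by
  have hiff : ∀ y, (letterRank col T y = letterRank col T x ∧
      (col x < col y ∨ col x = col y ∧ row y < row x)) ↔
      (letterRank col T y = letterRank col T x ∧ T y < T x) := by
    intro y
    refine and_congr_right fun hr => ⟨fun hb => ?_, fun hlt => ?_⟩
    · by_contra! hge
      rcases hge.eq_or_lt with h1 | h1
      · have := letterRank_inj h hT h1 hr.symm
        subst this
        omega
      · have := hL.col_le_col h hT h1 hr.ge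
        have h2 := hT.col_strict y x
        grind
    · have h1 := hL.col_le_col h hT hlt hr.le
      rcases h1.eq_or_lt with h1 | h1
      · refine Or.inr ⟨h1, ?_⟩
        by_contra! h2
        exact absurd (hT.col_strict x y h1) (by
          intro h3
          rcases h2.eq_or_lt with h4 | h4
          · rw [h.inj x y h4 h1] at hlt
            exact lt_irrefl _ hlt
          · exact lt_asymm hlt (h3 h4))
      · exact Or.inl h1
  simp only [hiff]
  rw [← Fin.card_Iio (T x)]
  refine Finset.card_bij (fun y _ => T y) ?_ ?_ ?_
  · intro y hy
    simp only [Finset.mem_filter, Finset.mem_univ, true_and] at hy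
    simpa using hy.2
  · intro y hy z hz hyz
    simp only [Finset.mem_filter, Finset.mem_univ, true_and] at hy hz
    exact letterRank_inj h hT hyz (hy.1.trans hz.1.symm)
  · intro a ha
    rw [Finset.mem_Iio] at ha
    obtain ⟨y, hy1, hy2⟩ := exists_letterRank_eq h hT
      ((letterRank_lt_wt (col := col) x).trans_le (hL.wt_antitone ha.le))
    exact ⟨y, by simp [hy1, hy2, ha], hy1⟩

/-- Transposing a diagram and conjugating the content does not decrease the lattice count. -/
theorem latticeCount_le_transpose (h : IsSkew row col) {w : Fin n → ℕ} (hw : ∀ a, w a ≤ m) :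
    latticeCount row col w ≤
      latticeCount col row fun i : Fin m => (Finset.univ.filter fun a => (i : ℕ) < w a).card := by
  classical
  rw [← latticeCount_neg h.transpose]
  · rw [latticeCount_eq_natCard, latticeCount_eq_natCard]
    have hm : ∀ T : {T : X → Fin n // (IsSemistd row col T ∧ IsLattice col T) ∧ wt T = w},
        ∀ a, wt T.1 a ≤ m := fun T a => by rw [T.2.2]; exact hw a
    refine Nat.card_le_card_of_injective (fun T => ⟨rankFilling col T.1 (hm T),
      ⟨rankFilling_isSemistd _ h T.2.1.1 T.2.1.2, rankFilling_isLattice _ h T.2.1.1⟩, ?_⟩) ?_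
    · ext i
      rw [wt_rankFilling _ h T.2.1.1, T.2.2]
    · intro T T' hTT
      have hr : letterRank col T.1 = letterRank col T'.1 := by
        ext x
        simpa [rankFilling] using congrFun (congrArg Subtype.val hTT) x
      ext x
      rw [← card_rank_eq_letter h T.2.1.1 T.2.1.2, ← card_rank_eq_letter h T'.2.1.1 T'.2.1.2, hr]
  · intro a b hab
    refine Finset.card_le_card fun c => ?_
    simp only [Finset.mem_filter, Finset.mem_univ, true_and]
    omega

end LetterRank

section RowReading

variable {X : Type*} [Fintype X] {n : ℕ} {row col : X → ℤ} {T : X → Fin n}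

/-- The lattice condition, read along rows from right to left. -/
def IsRowLattice (row col : X → ℤ) (T : X → Fin n) : Prop :=
  ∀ (x : X) (a b : Fin n), (a : ℕ) + 1 = b →
    (Finset.univ.filter fun y =>
      (row y < row x ∨ row y = row x ∧ col x ≤ col y) ∧ T y = b).card ≤
    (Finset.univ.filter fun y =>
      (row y < row x ∨ row y = row x ∧ col x ≤ col y) ∧ T y = a).card

theorem IsLattice.isRowLattice (h : IsSkew row col) (hT : IsSemistd row col T)
    (hL : IsLattice col T) : IsRowLattice row col T := by
  intro x a b hab
  have hlt : a < b := by rw [Fin.lt_def]; omega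
  rcases Finset.eq_empty_or_nonempty (Finset.univ.filter fun y =>
      (row y < row x ∨ row y = row x ∧ col x ≤ col y) ∧ T y = b) with hB | hB
  · simp [hB]
  obtain ⟨p, hp, hmin⟩ := Finset.exists_min_image _ col hB
  simp only [Finset.mem_filter, Finset.mem_univ, true_and] at hp hmin
  refine le_trans (Finset.card_le_card fun y hy => ?_)
    ((hL (col p) a b hab).trans (Finset.card_le_card fun z hz => ?_))
  · simp only [Finset.mem_filter, Finset.mem_univ, true_and] at hy ⊢
    exact ⟨hmin y hy, hy.2⟩
  · simp only [Finset.mem_filter, Finset.mem_univ, true_and] at hz ⊢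
    refine ⟨Or.inl ?_, hz.2⟩
    have : row z < row p := by
      by_contra! hr
      rcases hr.eq_or_lt with hr | hr
      · have := hT.row_weak p z hr hz.1
        grind
      · have := hT.lt_of_row_lt h hr hz.1
        grind
    omega

theorem IsRowLattice.isLattice (h : IsSkew row col) (hT : IsSemistd row col T)
    (hL : IsRowLattice row col T) : IsLattice col T := by
  classical
  intro j a b hab
  have hlt : a < b := by rw [Fin.lt_def]; omega
  rcases Finset.eq_empty_or_nonempty (Finset.univ.filter fun y => j ≤ col y ∧ T y = b) with hB | hB
  · simp [colWt, hB]
  obtain ⟨p, hp, hmin⟩ := Finset.exists_min_image _ col hB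
  simp only [Finset.mem_filter, Finset.mem_univ, true_and] at hp hmin
  obtain ⟨q, hq, hqmin⟩ := Finset.exists_min_image
    (Finset.univ.filter fun y => row y = row p ∧ T y = b) col ⟨p, by simp [hp]⟩
  simp only [Finset.mem_filter, Finset.mem_univ, true_and] at hq hqmin
  have hsub : (Finset.univ.filter fun y => j ≤ col y ∧ T y = b) ∪
      (Finset.univ.filter fun y => row y = row p ∧ col y < j ∧ T y = b) ⊆
      Finset.univ.filter fun y =>
        (row y < row q ∨ row y = row q ∧ col q ≤ col y) ∧ T y = b := by
    intro y
    simp only [Finset.mem_union, Finset.mem_filter, Finset.mem_univ, true_and]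
    rintro (hy | hy)
    · refine ⟨?_, hy.2⟩
      have hr : row y ≤ row p := by
        by_contra! hr
        have := hT.lt_of_row_lt h hr (hmin y hy)
        grind
      rcases hr.eq_or_lt with hr | hr
      · exact Or.inr ⟨hr.trans hq.1.symm, hqmin y ⟨hr, hy.2⟩⟩
      · exact Or.inl (by omega)
    · exact ⟨Or.inr ⟨hy.1.trans hq.1.symm, hqmin y ⟨hy.1, hy.2.2⟩⟩, hy.2.2⟩
  have hsub' : (Finset.univ.filter fun y =>
        (row y < row q ∨ row y = row q ∧ col q ≤ col y) ∧ T y = a) ⊆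
      (Finset.univ.filter fun y => j ≤ col y ∧ T y = a) ∪
      (Finset.univ.filter fun y => row y < row p ∧ col y < j ∧ T y = a) := by
    intro z
    simp only [Finset.mem_union, Finset.mem_filter, Finset.mem_univ, true_and]
    rintro ⟨hz | hz, hza⟩
    · rcases lt_or_ge (col z) j with hc | hc
      · exact Or.inr ⟨by omega, hc, hza⟩
      · exact Or.inl ⟨hc, hza⟩
    · have := hT.row_weak q z hz.1.symm hz.2
      grind
  have hbelow : ∀ z, ∃ u, row z < row p → col z < j → T z = a →
      row u = row p ∧ col u = col z ∧ T u = b := by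
    intro z
    by_cases hz : row z < row p ∧ col z < j ∧ T z = a
    · obtain ⟨u, hu1, hu2⟩ := h.convex z p (row p) (col z) hz.1.le le_rfl le_rfl (by omega)
      have h1 := hT.row_weak u p hu1 (by omega)
      have h2 := hT.col_strict z u hu2.symm (by omega)
      refine ⟨u, fun _ _ _ => ⟨hu1, hu2, ?_⟩⟩
      rw [hz.2.2, Fin.lt_def] at h2
      rw [hp.2, Fin.le_def] at h1
      omega
    · exact ⟨z, fun h1 h2 h3 => absurd ⟨h1, h2, h3⟩ hz⟩
  choose g hg using hbelow
  have hcard : (Finset.univ.filter fun y => row y < row p ∧ col y < j ∧ T y = a).card ≤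
      (Finset.univ.filter fun y => row y = row p ∧ col y < j ∧ T y = b).card := by
    refine Finset.card_le_card_of_injOn g ?_ ?_
    · intro z hz
      simp only [Finset.coe_filter, Finset.mem_univ, true_and, Set.mem_ofPred_eq] at hz ⊢
      obtain ⟨h1, h2, h3⟩ := hg z hz.1 hz.2.1 hz.2.2
      exact ⟨h1, by omega, h3⟩
    · intro z hz y hy hzy
      simp only [Finset.coe_filter, Finset.mem_univ, true_and, Set.mem_ofPred_eq] at hz hy
      obtain ⟨-, h2, -⟩ := hg z hz.1 hz.2.1 hz.2.2
      obtain ⟨-, h2', -⟩ := hg y hy.1 hy.2.1 hy.2.2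
      exact hT.eq_of_col_eq h (hz.2.2.trans hy.2.2.symm) (by rw [← h2, ← h2', hzy])
  have h1 := Finset.card_le_card hsub
  rw [Finset.card_union_of_disjoint (Finset.disjoint_left.2 fun y hy hy' => by
    simp only [Finset.mem_filter, Finset.mem_univ, true_and] at hy hy'
    omega)] at h1
  have h2 := (Finset.card_le_card hsub').trans (Finset.card_union_le _ _)
  have h3 := hL q a b hab
  simp only [colWt]
  omega

end RowReading

section Tableaux

/-- The cells of the skew diagram `lam/alpha`. -/
abbrev SkewCell (lam alpha : ℕ → ℕ) : Type := {p : ℕ × ℕ // inShape lam alpha p.1 p.2}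

/-- The row of a cell. -/
def cellRow (lam alpha : ℕ → ℕ) (x : SkewCell lam alpha) : ℤ := x.1.1

/-- The column of a cell. -/
def cellCol (lam alpha : ℕ → ℕ) (x : SkewCell lam alpha) : ℤ := x.1.2

variable {lam alpha beta : ℕ → ℕ}

theorem isSkew_skewCell (hl : Antitone lam) (ha : Antitone alpha) :
    IsSkew (cellRow lam alpha) (cellCol lam alpha) where
  inj x y h1 h2 := by
    simp only [cellRow, cellCol, Nat.cast_inj] at h1 h2
    exact Subtype.ext (Prod.ext h1 h2)
  convex x y r c h1 h2 h3 h4 := by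
    simp only [cellRow, cellCol] at *
    lift r to ℕ using by omega
    lift c to ℕ using by omega
    have hx := x.2.1
    have hy := y.2.2
    norm_cast at *
    exact ⟨⟨(r, c), (ha h1).trans (hx.trans h3), h4.trans_lt (hy.trans_le (hl h2))⟩, rfl, rfl⟩

theorem finite_skewCell (hl : IsPartition lam) : Finite (SkewCell lam alpha) := by
  obtain ⟨N, hN⟩ := hl.2
  refine Set.Finite.subset ((Set.finite_Iio N).prod (Set.finite_Iio (lam 0))) fun p hp => ?_
  refine ⟨?_, hp.2.trans_le (hl.1 (Nat.zero_le _))⟩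
  by_contra! hlt
  have h1 := hl.1 (show N ≤ p.1 by simpa using hlt)
  have h2 := hp.2
  omega

theorem natCard_skewCell [Fintype (SkewCell lam alpha)] (P : ℕ × ℕ → Prop) [DecidablePred P] :
    Nat.card {p : ℕ × ℕ // inShape lam alpha p.1 p.2 ∧ P p} =
      (Finset.univ.filter fun x : SkewCell lam alpha => P x.1).card := by
  rw [← Fintype.card_subtype, ← Nat.card_eq_fintype_card]
  exact Nat.card_congr (Equiv.subtypeSubtypeEquivSubtypeInter _ _).symm

theorem LRTableau.ext_entry {S T : LRTableau lam alpha beta} (h : S.entry = T.entry) : S = T := by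
  cases S
  cases T
  subst h
  rfl

theorem LRTableau.entry_le [Fintype (SkewCell lam alpha)] {n : ℕ} (hb : ∀ k, n ≤ k → beta k = 0)
    (S : LRTableau lam alpha beta) (r c : ℕ) : S.entry r c ≤ n := by
  classical
  by_contra! hlt
  have hin : inShape lam alpha r c := by
    by_contra hin
    have := S.zero_outside r c hin
    omega
  obtain ⟨k, hk⟩ := Nat.exists_eq_add_of_lt hlt
  have h1 := S.content (n + k)
  rw [natCard_skewCell (fun p => S.entry p.1 p.2 = n + k + 1), hb _ (by omega),
    Finset.card_eq_zero, Finset.filter_eq_empty_iff] at h1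
  exact h1 (Finset.mem_univ ⟨(r, c), hin⟩) hk

variable [Fintype (SkewCell lam alpha)] {n : ℕ}

/-- The filling of the cells by `Fin n` underlying a Littlewood–Richardson tableau. -/
def LRTableau.filling (hb : ∀ k, n ≤ k → beta k = 0) (S : LRTableau lam alpha beta)
    (x : SkewCell lam alpha) : Fin n :=
  ⟨S.entry x.1.1 x.1.2 - 1, by
    have h1 := S.entry_le hb x.1.1 x.1.2
    have h2 := S.one_le _ _ x.2
    omega⟩

theorem LRTableau.filling_eq_iff (hb : ∀ k, n ≤ k → beta k = 0) (S : LRTableau lam alpha beta)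
    (x : SkewCell lam alpha) (i : Fin n) :
    S.filling hb x = i ↔ S.entry x.1.1 x.1.2 = i + 1 := by
  have h2 := S.one_le _ _ x.2
  simp only [LRTableau.filling, Fin.ext_iff]
  omega

theorem LRTableau.filling_spec (hl : IsPartition lam) (ha : Antitone alpha)
    (hb : ∀ k, n ≤ k → beta k = 0) (S : LRTableau lam alpha beta) :
    (IsSemistd (cellRow lam alpha) (cellCol lam alpha) (S.filling hb) ∧
      IsLattice (cellCol lam alpha) (S.filling hb)) ∧
      wt (S.filling hb) = fun i : Fin n => beta i := by
  classical
  have hss : IsSemistd (cellRow lam alpha) (cellCol lam alpha) (S.filling hb) := by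
    constructor
    · rintro ⟨⟨r, c⟩, hx⟩ ⟨⟨r', c'⟩, hy⟩ h1 h2
      simp only [cellRow, cellCol, Nat.cast_inj, Nat.cast_le] at h1 h2
      subst h1
      have := S.row_weak r c c' h2 hx hy
      simp only [LRTableau.filling, Fin.mk_le_mk]
      omega
    · rintro ⟨⟨r, c⟩, hx⟩ ⟨⟨r', c'⟩, hy⟩ h1 h2
      simp only [cellRow, cellCol, Nat.cast_inj, Nat.cast_lt] at h1 h2
      subst h1
      have := S.col_strict r r' c h2 hx hy
      have := S.one_le r c hx
      change S.entry r c - 1 < S.entry r' c - 1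
      omega
  refine ⟨⟨hss, IsRowLattice.isLattice (isSkew_skewCell hl.1 ha) hss ?_⟩, ?_⟩
  · intro x a b hab
    have h1 := S.lattice x.1.1 x.1.2 a x.2
    simp only [← and_assoc] at h1
    simp only [and_assoc (a := inShape _ _ _ _)] at h1
    rw [natCard_skewCell (fun p => (p.1 < x.1.1 ∨ p.1 = x.1.1 ∧ x.1.2 ≤ p.2) ∧
        S.entry p.1 p.2 = a + 2),
      natCard_skewCell (fun p => (p.1 < x.1.1 ∨ p.1 = x.1.1 ∧ x.1.2 ≤ p.2) ∧
        S.entry p.1 p.2 = a + 1)] at h1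
    simpa [S.filling_eq_iff hb, cellRow, cellCol, ← hab, add_assoc] using h1
  · ext i
    rw [← S.content i, natCard_skewCell (fun p => S.entry p.1 p.2 = i + 1), wt]
    simp only [S.filling_eq_iff hb]

open Classical in
/-- The entries of the tableau obtained from a filling of the cells by `Fin n`. -/
noncomputable def entryOfFilling (T : SkewCell lam alpha → Fin n) (r c : ℕ) : ℕ :=
  if h : inShape lam alpha r c then (T ⟨(r, c), h⟩ : ℕ) + 1 else 0

omit [Fintype (SkewCell lam alpha)] in
theorem entryOfFilling_of_inShape (T : SkewCell lam alpha → Fin n) {r c : ℕ}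
    (h : inShape lam alpha r c) : entryOfFilling T r c = (T ⟨(r, c), h⟩ : ℕ) + 1 := by
  simp [entryOfFilling, h]

omit [Fintype (SkewCell lam alpha)] in
theorem entryOfFilling_cell (T : SkewCell lam alpha → Fin n) (x : SkewCell lam alpha) :
    entryOfFilling T x.1.1 x.1.2 = (T x : ℕ) + 1 :=
  entryOfFilling_of_inShape T x.2

/-- The Littlewood–Richardson tableau of a lattice semistandard filling. -/
noncomputable def tableauOfFilling (hl : IsPartition lam) (ha : Antitone alpha)
    (hb : ∀ k, n ≤ k → beta k = 0) (T : SkewCell lam alpha → Fin n)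
    (hT : (IsSemistd (cellRow lam alpha) (cellCol lam alpha) T ∧
      IsLattice (cellCol lam alpha) T) ∧ wt T = fun i : Fin n => beta i) :
    LRTableau lam alpha beta where
  entry := entryOfFilling T
  zero_outside r c h := by simp [entryOfFilling, h]
  one_le r c h := by simp [entryOfFilling, h]
  row_weak r c₁ c₂ h h1 h2 := by
    have := hT.1.1.row_weak ⟨(r, c₁), h1⟩ ⟨(r, c₂), h2⟩ rfl (by simpa [cellCol] using h)
    simpa [entryOfFilling, h1, h2] using this
  col_strict r₁ r₂ c h h1 h2 := by
    have := hT.1.1.col_strict ⟨(r₁, c), h1⟩ ⟨(r₂, c), h2⟩ rfl (by simpa [cellRow] using h)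
    simpa [entryOfFilling, h1, h2] using this
  content k := by
    classical
    rw [natCard_skewCell (fun p => entryOfFilling T p.1 p.2 = k + 1)]
    simp only [entryOfFilling_cell, Nat.add_right_cancel_iff]
    by_cases hk : k < n
    · rw [← congrFun hT.2 ⟨k, hk⟩, wt]
      simp only [Fin.ext_iff]
    · rw [hb k (by omega), Finset.card_eq_zero, Finset.filter_eq_empty_iff]
      intro x _ hx
      have := (T x).isLt
      omega
  lattice r c k h := by
    classical
    simp only [← and_assoc]
    simp only [and_assoc (a := inShape _ _ _ _)]
    rw [natCard_skewCell (fun p => (p.1 < r ∨ p.1 = r ∧ c ≤ p.2) ∧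
        entryOfFilling T p.1 p.2 = k + 2),
      natCard_skewCell (fun p => (p.1 < r ∨ p.1 = r ∧ c ≤ p.2) ∧
        entryOfFilling T p.1 p.2 = k + 1)]
    simp only [entryOfFilling_cell]
    by_cases hk : k + 1 < n
    · have h1 := hT.1.2.isRowLattice (isSkew_skewCell hl.1 ha) hT.1.1 ⟨(r, c), h⟩
        ⟨k, by omega⟩ ⟨k + 1, hk⟩ rfl
      simpa [cellRow, cellCol, Fin.ext_iff] using h1
    · rw [Finset.filter_false_of_mem]
      · simp
      · intro x _ hx
        have := (T x).isLt
        omega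

/-- Littlewood–Richardson tableaux are counted by lattice fillings of the skew diagram. -/
theorem natCard_LRTableau (hl : IsPartition lam) (ha : Antitone alpha)
    (hb : ∀ k, n ≤ k → beta k = 0) :
    Nat.card (LRTableau lam alpha beta) =
      latticeCount (cellRow lam alpha) (cellCol lam alpha) fun i : Fin n => beta i := by
  rw [latticeCount_eq_natCard]
  refine Nat.card_congr ⟨fun S => ⟨S.filling hb, S.filling_spec hl ha hb⟩,
    fun T => tableauOfFilling hl ha hb T.1 T.2, fun S => ?_, fun T => ?_⟩
  · refine LRTableau.ext_entry ?_
    ext r c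
    by_cases h : inShape lam alpha r c
    · have := S.one_le r c h
      simp only [tableauOfFilling, entryOfFilling_of_inShape _ h, LRTableau.filling]
      omega
    · simp [tableauOfFilling, entryOfFilling, h, S.zero_outside r c h]
  · ext x
    simp [tableauOfFilling, LRTableau.filling, entryOfFilling_cell]

end Tableaux

section Conjugation

theorem lt_conjP_iff {f : ℕ → ℕ} (hf : IsPartition f) (r c : ℕ) : r < conjP f c ↔ c < f r := by
  obtain ⟨N, hN⟩ := hf.2
  have hex : ∃ M, f M ≤ c := ⟨N, by omega⟩
  have hiff : ∀ i, c < f i ↔ i < Nat.find hex := by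
    intro i
    rw [Nat.lt_find_iff]
    exact ⟨fun h m hm => not_le.2 (h.trans_le (hf.1 hm)), fun h => not_le.1 (h i le_rfl)⟩
  rw [hiff, conjP, Nat.card_congr (Equiv.subtypeEquivRight hiff)]
  generalize Nat.find hex = k
  rw [← Nat.card_congr (Fin.equivSubtype (n := k)), Nat.card_fin]

theorem conjP_isPartition {f : ℕ → ℕ} (hf : IsPartition f) : IsPartition (conjP f) := by
  refine ⟨fun a b hab => ?_, f 0, ?_⟩
  · refine le_of_forall_lt fun r hr => ?_
    rw [lt_conjP_iff hf] at hr ⊢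
    omega
  · by_contra h
    have := (lt_conjP_iff hf 0 (f 0)).1 (Nat.pos_of_ne_zero h)
    omega

theorem conjP_conjP {f : ℕ → ℕ} (hf : IsPartition f) : conjP (conjP f) = f := by
  ext i
  refine eq_of_forall_lt_iff fun r => ?_
  rw [lt_conjP_iff (conjP_isPartition hf), lt_conjP_iff hf]

theorem complP_isPartition (m : ℕ) {f : ℕ → ℕ} (hf : IsPartition f) :
    IsPartition (complP m f) := by
  refine ⟨fun a b hab => ?_, m, by simp [complP]⟩
  have := hf.1 (show m - 1 - b ≤ m - 1 - a by omega)
  simp only [complP]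
  split_ifs <;> omega

theorem conjP_complP (m : ℕ) {f : ℕ → ℕ} (hf : IsPartition f) :
    conjP (complP m f) = complP m (conjP f) := by
  ext c
  refine eq_of_forall_lt_iff fun r => ?_
  rw [lt_conjP_iff (complP_isPartition m hf)]
  have := lt_conjP_iff hf (m - 1 - r) (m - 1 - c)
  simp only [complP]
  split_ifs <;> omega

theorem plen_eq_conjP {f : ℕ → ℕ} (hf : IsPartition f) : plen f = conjP f 0 := by
  refine eq_of_forall_lt_iff fun r => ?_
  rw [lt_conjP_iff hf, plen]
  have hne : {n | f n = 0}.Nonempty := hf.2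
  constructor
  · intro hr
    have := Nat.notMem_of_lt_sInf hr
    simpa [Nat.pos_iff_ne_zero] using this
  · intro hr
    by_contra! hle
    have h1 := hf.1 hle
    have h2 : f (sInf {n | f n = 0}) = 0 := Nat.sInf_mem hne
    omega

theorem subP_conjP {f g : ℕ → ℕ} (hf : IsPartition f) (hg : IsPartition g) (h : subP f g) :
    subP (conjP f) (conjP g) := by
  intro i
  refine le_of_forall_lt fun r hr => ?_
  rw [lt_conjP_iff hf] at hr
  rw [lt_conjP_iff hg]
  exact hr.trans_le (h r)

theorem inShape_conjP {lam alpha : ℕ → ℕ} (hl : IsPartition lam) (ha : IsPartition alpha)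
    (r c : ℕ) : inShape (conjP lam) (conjP alpha) r c ↔ inShape lam alpha c r := by
  have h1 := lt_conjP_iff hl c r
  have h2 := lt_conjP_iff ha c r
  simp only [inShape]
  omega

/-- Transport of lattice counts along a bijection of cells. -/
theorem latticeCount_comp_equiv {X Y : Type*} [Fintype X] [Fintype Y] (e : X ≃ Y)
    (row col : Y → ℤ) {n : ℕ} (w : Fin n → ℕ) :
    latticeCount (row ∘ e) (col ∘ e) w = latticeCount row col w := by
  have hwt : ∀ T : Y → Fin n, wt (T ∘ e) = wt T := fun T => by
    ext i
    exact Finset.card_equiv e (by simp)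
  have hcol : ∀ (T : Y → Fin n) j, colWt (col ∘ e) (T ∘ e) j = colWt col T j := fun T j => by
    ext i
    exact Finset.card_equiv e (by simp)
  rw [latticeCount_eq_natCard, latticeCount_eq_natCard]
  refine (Nat.card_congr ((e.symm.arrowCongr (Equiv.refl _)).subtypeEquiv fun T => ?_)).symm
  have heq : e.symm.arrowCongr (Equiv.refl (Fin n)) T = T ∘ e := rfl
  rw [heq, hwt]
  simp only [IsLattice, hcol]
  refine and_congr_left fun _ => and_congr_left fun _ => ⟨fun hT => ?_, fun hT => ?_⟩
  · exact ⟨fun x y => hT.row_weak _ _, fun x y => hT.col_strict _ _⟩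
  · exact ⟨fun x y h1 h2 => by simpa using hT.row_weak (e.symm x) (e.symm y) (by simpa) (by simpa),
      fun x y h1 h2 => by simpa using hT.col_strict (e.symm x) (e.symm y) (by simpa) (by simpa)⟩

theorem LRcoeff_le_conjP {lam alpha beta : ℕ → ℕ} (hl : IsPartition lam) (ha : IsPartition alpha)
    (hb : IsPartition beta) :
    LRcoeff lam alpha beta ≤ LRcoeff (conjP lam) (conjP alpha) (conjP beta) := by
  classical
  by_cases hsub : subP alpha lam
  swap
  · simp [LRcoeff, hsub]
  rw [LRcoeff, LRcoeff, if_pos hsub, if_pos (subP_conjP ha hl hsub)]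
  have := finite_skewCell (alpha := alpha) hl
  have := finite_skewCell (alpha := conjP alpha) (conjP_isPartition hl)
  have := Fintype.ofFinite (SkewCell lam alpha)
  have := Fintype.ofFinite (SkewCell (conjP lam) (conjP alpha))
  obtain ⟨n, hn⟩ := hb.2
  have hbn : ∀ k, n ≤ k → beta k = 0 := fun k hk => by
    have := hb.1 hk
    omega
  have hbm : ∀ k, beta 0 ≤ k → conjP beta k = 0 := fun k hk => by
    by_contra h
    have := (lt_conjP_iff hb 0 k).1 (Nat.pos_of_ne_zero h)
    omega
  rw [natCard_LRTableau hl ha.1 hbn,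
    natCard_LRTableau (conjP_isPartition hl) (conjP_isPartition ha).1 hbm]
  refine (latticeCount_le_transpose (isSkew_skewCell hl.1 ha.1) (m := beta 0)
    fun a => hb.1 (Nat.zero_le _)).trans_eq ?_
  let e : SkewCell lam alpha ≃ SkewCell (conjP lam) (conjP alpha) :=
    (Equiv.prodComm ℕ ℕ).subtypeEquiv fun p => (inShape_conjP hl ha p.2 p.1).symm
  rw [← latticeCount_comp_equiv e]
  have hw : (fun i : Fin (beta 0) => (Finset.univ.filter fun a : Fin n => (i : ℕ) < beta a).card) =
      fun i : Fin (beta 0) => conjP beta i := by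
    ext i
    have hle : conjP beta i ≤ n := by
      by_contra! h
      have := (lt_conjP_iff hb n i).1 h
      omega
    simp_rw [← lt_conjP_iff hb]
    rw [Fin.card_filter_val_lt, min_eq_right hle]
  rw [hw]
  rfl

theorem LRcoeff_conjP {lam alpha beta : ℕ → ℕ} (hl : IsPartition lam) (ha : IsPartition alpha)
    (hb : IsPartition beta) :
    LRcoeff (conjP lam) (conjP alpha) (conjP beta) = LRcoeff lam alpha beta := by
  refine le_antisymm ?_ (LRcoeff_le_conjP hl ha hb)
  have := LRcoeff_le_conjP (conjP_isPartition hl) (conjP_isPartition ha) (conjP_isPartition hb)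
  rwa [conjP_conjP hl, conjP_conjP ha, conjP_conjP hb] at this

end Conjugation

/-- if `μ` covers `ν`, then `μ'` covers `ν'`. -/
theorem covers_conjugate (nu mu : ℕ → ℕ)
    (hnu : IsPartition nu) (hmu : IsPartition mu)
    (hsub : subP nu mu) (hsz : psize mu = psize nu + 1)
    (h : Covers mu nu) :
    Covers (conjP mu) (conjP nu) := by
  intro m hm lam hl
  rw [plen_eq_conjP (conjP_isPartition hmu), conjP_conjP hmu, ← plen_eq_conjP hmu, add_comm] at hm
  have hl' := conjP_isPartition hl
  have key : ∀ f, IsPartition f → LRcoeff lam (complP m (conjP f)) (conjP (conjP f)) =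
      LRcoeff (conjP lam) (complP m f) (conjP f) := fun f hf => by
    rw [← LRcoeff_conjP hl' (complP_isPartition m hf) (conjP_isPartition hf), conjP_conjP hl,
      conjP_complP m hf]
  rw [key nu hnu, key mu hmu]
  exact h m hm _ hl'
end

section
/- For a partition ν and integer k ≥ 1, let ν^{(k)} be the partition obtained by deleting the first k columns of ν (its parts are the positive values among ν_j − k), and let ν_{(s)} = (ν_{s+1}, ν_{s+2}, …) be the partition obtained by deleting the first s rows of ν. Then: (i) if ν is of type 1 and 1 ≤ k ≤ ν₁ − 1, then ν^{(k)} is of type 1; (ii) if ν = β + (s^s) + α is of type 2 and 1 ≤ k ≤ β₁, then ν^{(k)} is of type 2; (iii) if ν = β + (s^s) + α is of type 2, then ν_{(s)} is of type 1 (possibly empty, the empty partition counting as type 1). -/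
/-- A partition vanishes from its length onwards. -/
theorem IsPartition.eq_zero_of_plen_le {f : ℕ → ℕ} (hf : IsPartition f) {j : ℕ}
    (hj : plen f ≤ j) : f j = 0 := by
  have h : f (plen f) = 0 := Nat.sInf_mem (s := {n | f n = 0}) hf.2
  have := hf.1 hj
  omega

theorem IsPartition.colDel {f : ℕ → ℕ} (hf : IsPartition f) (k : ℕ) :
    IsPartition (colDel k f) := by
  obtain ⟨h, N, hN⟩ := hf
  refine ⟨fun a b hab => Nat.sub_le_sub_right (h hab) k, N, ?_⟩
  simp [_root_.colDel, hN]

theorem subP_betaShape_colDel {f : ℕ → ℕ} {s : ℕ} (hf : subP (betaShape (f 0) s) f) (k : ℕ) :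
    subP (betaShape (colDel k f 0) s) (colDel k f) := by
  intro j
  have h := hf j
  simp only [betaShape, colDel] at h ⊢
  split_ifs at h ⊢ <;> omega

/-- removing columns or rows and the type of a partition. -/
theorem remove_rows_columns :
    (∀ nu : ℕ → ℕ, ∀ k : ℕ, Type1 nu → 1 ≤ k → k ≤ nu 0 - 1 → Type1 (colDel k nu)) ∧
    (∀ nu beta alpha : ℕ → ℕ, ∀ s k : ℕ, IsType2Decomp nu beta s alpha →
      1 ≤ k → k ≤ beta 0 → Type2 (colDel k nu)) ∧
    (∀ nu beta alpha : ℕ → ℕ, ∀ s : ℕ, IsType2Decomp nu beta s alpha →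
      Type1 (rowDel s nu)) := by
  refine ⟨fun nu k h _ _ => ⟨h.1.colDel k, subP_betaShape_colDel h.2 k⟩, ?_, ?_⟩
  · rintro nu beta alpha s k ⟨hb, ha, hs, ha0, hal, hsub, hnu⟩ _ hk
    refine ⟨colDel k beta, s, alpha, hb.colDel k, ha, hs, ha0, hal,
      subP_betaShape_colDel hsub k, fun j => ?_⟩
    have h := hsub j
    have hz : s ≤ j → alpha j = 0 := fun hj => ha.eq_zero_of_plen_le (hal.trans hj)
    simp only [colDel, hnu, squareP, betaShape] at h ⊢
    split_ifs at h ⊢ <;> omega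
  · rintro nu beta alpha s ⟨hb, ha, -, -, hal, hsub, hnu⟩
    have hrow : rowDel s nu = fun j => beta (j + s) := by
      funext j
      simp [rowDel, hnu, squareP, ha.eq_zero_of_plen_le (hal.trans (Nat.le_add_left s j))]
    have hbs : beta (0 + s) ≤ beta 0 := hb.1 (Nat.zero_le _)
    obtain ⟨N, hN⟩ := hb.2
    rw [hrow]
    refine ⟨⟨fun a b hab => hb.1 (Nat.add_le_add_right hab s), N, ?_⟩, fun j => ?_⟩
    · exact Nat.eq_zero_of_le_zero (hN ▸ hb.1 (Nat.le_add_right N s))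
    · have h := hsub (j + s)
      simp only [betaShape] at h ⊢
      split_ifs at h ⊢ <;> omega
end
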